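/- arXiv:2209.15055 — 2 statements merged into one kernel-verified Lean document; each statement's English description precedes it below -/
import Mathlib

section
/- Fix a ∈ (−1,1), a real d_out × d_in matrix A, b ∈ ℝ^{d_out}, and a nonempty bounded open set Ω ⊆ ℝ^{d_in}. For the affine map f(x) = Ax + b, the limit lim_{L→∞} R(f;Ω,σ_a,L)/L exists and equals rank(A). -/
noncomputable section

open scoped ENNReal

/-- The homogeneous nonlinearity σ_a. -/
def sigmaA (a x : ℝ) : ℝ := if 0 ≤ x then x else a * x

/-- Output of a fully connected network of depth `ℓ+1` with nonlinearity `σ_a`, widths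
`n 0, …, n (ℓ+1)`, weight matrices `W` and biases `b` (the last layer is affine, all
previous layers are followed by the entrywise nonlinearity). -/
def netOut (a : ℝ) (n : ℕ → ℕ) (W : ∀ ℓ, Matrix (Fin (n (ℓ + 1))) (Fin (n ℓ)) ℝ)
    (b : ∀ ℓ, Fin (n (ℓ + 1)) → ℝ) : (ℓ : ℕ) → (Fin (n 0) → ℝ) → (Fin (n (ℓ + 1)) → ℝ)
  | 0, x => (W 0).mulVec x + b 0
  | (ℓ + 1), x => (W (ℓ + 1)).mulVec (fun i => sigmaA a (netOut a n W b ℓ x i)) + b (ℓ + 1)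

/-- Squared parameter norm of a depth-`L` network: sum of squared Frobenius norms of the
weight matrices and squared Euclidean norms of the biases. -/
def paramNorm (n : ℕ → ℕ) (W : ∀ ℓ, Matrix (Fin (n (ℓ + 1))) (Fin (n ℓ)) ℝ)
    (b : ∀ ℓ, Fin (n (ℓ + 1)) → ℝ) (L : ℕ) : ℝ :=
  ∑ ℓ ∈ Finset.range L, ((∑ i, ∑ j, (W ℓ i j) ^ 2) + ∑ i, (b ℓ i) ^ 2)

/-- Representation cost `R(f; Ω, σ_a, L)`: the infimum of the squared parameter norm over
all depth-`L` networks (arbitrary finite hidden widths) representing `f` on `Ω`; it is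
`∞` if no such network exists. -/
def repCost {din dout : ℕ} (a : ℝ)
    (f : EuclideanSpace ℝ (Fin din) → EuclideanSpace ℝ (Fin dout))
    (Ω : Set (EuclideanSpace ℝ (Fin din))) (L : ℕ) : ℝ≥0∞ :=
  sInf { c | ∃ L' : ℕ, L = L' + 1 ∧ ∃ (n : ℕ → ℕ) (h0 : n 0 = din) (hL : n (L' + 1) = dout)
    (W : ∀ ℓ, Matrix (Fin (n (ℓ + 1))) (Fin (n ℓ)) ℝ) (b : ∀ ℓ, Fin (n (ℓ + 1)) → ℝ),
    (∀ x ∈ Ω, ∀ j : Fin dout,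
      netOut a n W b L' (fun i => x (Fin.cast h0 i)) (Fin.cast hL.symm j) = f x j) ∧
    c = ENNReal.ofReal (paramNorm n W b (L' + 1)) }

open Matrix in
theorem det_le_exp_trace_sub {r : ℕ} {H : Matrix (Fin r) (Fin r) ℝ} (hH : H.PosSemidef) :
    H.det ≤ Real.exp (H.trace - r) := by
  rw [hH.1.det_eq_prod_eigenvalues, hH.1.trace_eq_sum_eigenvalues]
  have : (∑ i, (hH.1.eigenvalues i : ℝ)) - r = ∑ i, (hH.1.eigenvalues i - 1) := by
    simp [Finset.sum_sub_distrib]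
  simp only [RCLike.ofReal_real_eq_id, id_eq]
  rw [this, Real.exp_sum]
  refine Finset.prod_le_prod (fun i _ => hH.eigenvalues_nonneg i) fun i _ => ?_
  have := Real.add_one_le_exp (hH.1.eigenvalues i - 1)
  linarith

open Matrix in
theorem trace_transpose_mul_self {m k : ℕ} (M : Matrix (Fin m) (Fin k) ℝ) :
    (Mᵀ * M).trace = ∑ i, ∑ j, M i j ^ 2 := by
  rw [Finset.sum_comm]
  simp [Matrix.trace, Matrix.mul_apply, sq]

open Matrix in
theorem sum_sq_mul_le_of_orthonormal {m k r : ℕ} (M : Matrix (Fin m) (Fin k) ℝ)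
    (Q : Matrix (Fin k) (Fin r) ℝ) (hQ : Qᵀ * Q = 1) :
    ((M * Q)ᵀ * (M * Q)).trace ≤ ∑ i, ∑ j, M i j ^ 2 := by
  rw [← trace_transpose_mul_self]
  set E : Matrix (Fin k) (Fin k) ℝ := 1 - Q * Qᵀ with hE
  have hEE : E * Eᵀ = 1 - Q * Qᵀ := by
    have h1 : Q * Qᵀ * (Q * Qᵀ) = Q * Qᵀ := by
      rw [Matrix.mul_assoc, ← Matrix.mul_assoc Qᵀ, hQ, Matrix.one_mul]
    simp only [hE, transpose_sub, transpose_one, transpose_mul, transpose_transpose]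
    rw [Matrix.sub_mul, Matrix.one_mul, Matrix.mul_sub, h1, Matrix.mul_one, sub_self, sub_zero]
  have h2 : 0 ≤ ((M * E)ᵀ * (M * E)).trace := by
    rw [trace_transpose_mul_self]; positivity
  have h3 : ((M * E)ᵀ * (M * E)).trace = (Mᵀ * M).trace - ((M * Q)ᵀ * (M * Q)).trace := by
    rw [Matrix.trace_mul_comm, Matrix.trace_mul_comm (M * Q)ᵀ, Matrix.trace_mul_comm Mᵀ]
    simp only [transpose_mul]
    rw [Matrix.mul_assoc M E, ← Matrix.mul_assoc E, hEE, Matrix.sub_mul, Matrix.mul_sub,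
      Matrix.trace_sub]
    simp only [Matrix.one_mul, Matrix.mul_assoc]
  linarith

open Matrix MatrixOrder in
theorem exists_transpose_mul_self_eq {r : ℕ} {G : Matrix (Fin r) (Fin r) ℝ} (hG : G.PosSemidef) :
    ∃ B : Matrix (Fin r) (Fin r) ℝ, G = Bᵀ * B := by
  obtain ⟨B, hB⟩ := CStarAlgebra.nonneg_iff_eq_star_mul_self.mp hG.nonneg
  exact ⟨B, by rw [hB, star_eq_conjTranspose, conjTranspose_eq_transpose_of_trivial]⟩

open Matrix in
theorem posSemidef_transpose_mul_self {k r : ℕ} (V : Matrix (Fin k) (Fin r) ℝ) :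
    (Vᵀ * V).PosSemidef := by
  simpa [conjTranspose_eq_transpose_of_trivial] using posSemidef_conjTranspose_mul_self V

open Matrix in
/-- Multiplying by `M` increases the Gram determinant of `r` vectors at most by the factor
`exp (‖M‖² - r)`, with `‖M‖` the Frobenius norm. -/
theorem det_gram_mul_le {m k r : ℕ} (M : Matrix (Fin m) (Fin k) ℝ)
    (V : Matrix (Fin k) (Fin r) ℝ) :
    ((M * V)ᵀ * (M * V)).det ≤ Real.exp ((∑ i, ∑ j, M i j ^ 2) - r) * (Vᵀ * V).det := by
  by_cases h0 : (Vᵀ * V).det = 0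
  · obtain ⟨v, hv, hv0⟩ := exists_mulVec_eq_zero_iff.mpr h0
    rw [← conjTranspose_eq_transpose_of_trivial, conjTranspose_mul_self_mulVec_eq_zero] at hv0
    rw [h0, mul_zero]
    refine (exists_mulVec_eq_zero_iff.mp ⟨v, hv, ?_⟩).le
    rw [← mulVec_mulVec, ← mulVec_mulVec, hv0, mulVec_zero, mulVec_zero]
  · obtain ⟨B, hB⟩ := exists_transpose_mul_self_eq (posSemidef_transpose_mul_self V)
    have hdet : (Vᵀ * V).det = B.det ^ 2 := by rw [hB, det_mul, det_transpose, sq]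
    have hBu : IsUnit B.det := by
      rw [isUnit_iff_ne_zero]; rintro h; apply h0; rw [hdet, h]; simp
    have hVB : V = V * B⁻¹ * B := by rw [Matrix.mul_assoc, nonsing_inv_mul _ hBu, Matrix.mul_one]
    set Q := V * B⁻¹ with hQdef
    have hQ : Qᵀ * Q = 1 := by
      rw [hQdef, transpose_mul, Matrix.mul_assoc, ← Matrix.mul_assoc Vᵀ, hB, Matrix.mul_assoc,
        mul_nonsing_inv _ hBu, Matrix.mul_one, ← transpose_mul, mul_nonsing_inv _ hBu,
        transpose_one]
    have h1 : ((M * V)ᵀ * (M * V)).det = ((M * Q)ᵀ * (M * Q)).det * B.det ^ 2 := by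
      have : (M * V)ᵀ * (M * V) = Bᵀ * ((M * Q)ᵀ * (M * Q)) * B := by
        conv_lhs => rw [hVB]
        simp only [transpose_mul, Matrix.mul_assoc]
      rw [this, det_mul, det_mul, det_transpose]; ring
    rw [h1, hdet]
    refine mul_le_mul_of_nonneg_right ?_ (sq_nonneg _)
    refine (det_le_exp_trace_sub (posSemidef_transpose_mul_self _)).trans ?_
    exact Real.exp_le_exp.mpr (sub_le_sub_right (sum_sq_mul_le_of_orthonormal M Q hQ) _)

/-- On some nonempty open subset of `U`, every one of finitely many continuous functions has
constant sign, so that `sigmaA` acts there by constant slopes. -/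
theorem exists_open_sigmaA_eq_mul {X : Type*} [TopologicalSpace X] (a : ℝ) {m : ℕ}
    (g : Fin m → X → ℝ) (hg : ∀ i, Continuous (g i)) {U : Set X} (hU : IsOpen U)
    (hne : U.Nonempty) :
    ∃ U' ⊆ U, IsOpen U' ∧ U'.Nonempty ∧ ∃ d : Fin m → ℝ, (∀ i, d i = 1 ∨ d i = a) ∧
      ∀ x ∈ U', ∀ i, sigmaA a (g i x) = d i * g i x := by
  suffices h : ∀ s : Finset (Fin m), ∃ U' ⊆ U, IsOpen U' ∧ U'.Nonempty ∧
      ∃ d : Fin m → ℝ, (∀ i, d i = 1 ∨ d i = a) ∧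
        ∀ x ∈ U', ∀ i ∈ s, sigmaA a (g i x) = d i * g i x by
    simpa using h Finset.univ
  intro s
  induction s using Finset.induction_on with
  | empty => exact ⟨U, subset_rfl, hU, hne, fun _ => 1, by simp, by simp⟩
  | insert i s his ih =>
    obtain ⟨U', hsub, hopen, hne', d, hd, hσ⟩ := ih
    have key : ∀ (c : ℝ) (U'' : Set X), (c = 1 ∨ c = a) → U'' ⊆ U' →
        (∀ x ∈ U'', sigmaA a (g i x) = c * g i x) → ∀ x ∈ U'', ∀ j ∈ insert i s,
          sigmaA a (g j x) = Function.update d i c j * g j x := by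
      intro c U'' _ hU'' h x hx j hj
      by_cases hji : j = i
      · subst hji; simpa using h x hx
      · rw [Function.update_of_ne hji]
        exact hσ x (hU'' hx) j ((Finset.mem_insert.mp hj).resolve_left hji)
    have hupd : ∀ c : ℝ, (c = 1 ∨ c = a) → ∀ j, Function.update d i c j = 1 ∨
        Function.update d i c j = a := by
      intro c hc j
      by_cases hji : j = i
      · subst hji; simpa using hc
      · simpa [Function.update_of_ne hji] using hd j
    by_cases hneg : ∃ x ∈ U', g i x < 0
    · obtain ⟨x, hx, hxi⟩ := hneg
      refine ⟨U' ∩ {x | g i x < 0}, Set.inter_subset_left.trans hsub,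
        hopen.inter (isOpen_lt (hg i) continuous_const), ⟨x, hx, hxi⟩, Function.update d i a,
        hupd a (Or.inr rfl), key a _ (Or.inr rfl) Set.inter_subset_left ?_⟩
      rintro y ⟨-, hy⟩
      simp [sigmaA, not_le.mpr (show g i y < 0 from hy)]
    · push Not at hneg
      refine ⟨U', hsub, hopen, hne', Function.update d i 1, hupd 1 (Or.inl rfl),
        key 1 _ (Or.inl rfl) subset_rfl fun y hy => ?_⟩
      simp [sigmaA, hneg y hy]

theorem paramNorm_succ (n : ℕ → ℕ) (W : ∀ ℓ, Matrix (Fin (n (ℓ + 1))) (Fin (n ℓ)) ℝ)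
    (b : ∀ ℓ, Fin (n (ℓ + 1)) → ℝ) (L : ℕ) :
    paramNorm n W b (L + 1) =
      paramNorm n W b L + ((∑ i, ∑ j, W L i j ^ 2) + ∑ i, b L i ^ 2) :=
  Finset.sum_range_succ _ _

open Matrix in
/-- On some nonempty open subset of `U` the network is affine, and its linear part increases the
Gram determinant of `r` vectors at most by `exp (‖W‖² - r * depth)`. -/
theorem exists_open_netOut_affine {a : ℝ} (ha : a ∈ Set.Ioo (-1 : ℝ) 1) (n : ℕ → ℕ)
    (W : ∀ ℓ, Matrix (Fin (n (ℓ + 1))) (Fin (n ℓ)) ℝ) (b : ∀ ℓ, Fin (n (ℓ + 1)) → ℝ)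
    {U : Set (Fin (n 0) → ℝ)} (hU : IsOpen U) (hne : U.Nonempty) {r : ℕ}
    (V : Matrix (Fin (n 0)) (Fin r) ℝ) (ℓ : ℕ) :
    ∃ U' ⊆ U, IsOpen U' ∧ U'.Nonempty ∧
      ∃ (M : Matrix (Fin (n (ℓ + 1))) (Fin (n 0)) ℝ) (c : Fin (n (ℓ + 1)) → ℝ),
        (∀ x ∈ U', netOut a n W b ℓ x = M *ᵥ x + c) ∧
        ((M * V)ᵀ * (M * V)).det ≤
          Real.exp (paramNorm n W b (ℓ + 1) - r * (ℓ + 1)) * (Vᵀ * V).det := by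
  have hdetV : 0 ≤ (Vᵀ * V).det := (posSemidef_transpose_mul_self V).det_nonneg
  induction ℓ with
  | zero =>
    refine ⟨U, subset_rfl, hU, hne, W 0, b 0, fun x _ => rfl,
      (det_gram_mul_le (W 0) V).trans (mul_le_mul_of_nonneg_right ?_ hdetV)⟩
    have : 0 ≤ ∑ i, b 0 i ^ 2 := by positivity
    simp only [paramNorm, zero_add, Finset.range_one, Finset.sum_singleton, Real.exp_le_exp]
    push_cast
    linarith
  | succ ℓ ih =>
    obtain ⟨U₁, hsub, hopen, hne₁, M, c, hM, hdet⟩ := ih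
    obtain ⟨U₂, hsub₂, hopen₂, hne₂, d, hd, hσ⟩ := exists_open_sigmaA_eq_mul a
      (fun i x => (M *ᵥ x + c) i) (fun i => by
        simp only [Pi.add_apply, mulVec, dotProduct]; fun_prop) hopen hne₁
    refine ⟨U₂, hsub₂.trans hsub, hopen₂, hne₂, W (ℓ + 1) * diagonal d * M,
      (W (ℓ + 1) * diagonal d) *ᵥ c + b (ℓ + 1), fun x hx => ?_, ?_⟩
    · have : (fun i => sigmaA a (netOut a n W b ℓ x i)) = diagonal d *ᵥ (M *ᵥ x + c) := by
        funext i
        rw [hM x (hsub₂ hx), mulVec_diagonal]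
        exact hσ x hx i
      rw [netOut, this, mulVec_mulVec, mulVec_add, mulVec_mulVec]
      exact add_assoc _ _ _
    · rw [Matrix.mul_assoc (W (ℓ + 1) * diagonal d)]
      refine (det_gram_mul_le _ (M * V)).trans ?_
      refine (mul_le_mul_of_nonneg_left hdet (Real.exp_pos _).le).trans ?_
      rw [← mul_assoc, ← Real.exp_add]
      refine mul_le_mul_of_nonneg_right (Real.exp_le_exp.mpr ?_) hdetV
      have h1 : ∑ i, ∑ j, (W (ℓ + 1) * diagonal d) i j ^ 2 ≤ ∑ i, ∑ j, W (ℓ + 1) i j ^ 2 := by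
        refine Finset.sum_le_sum fun i _ => Finset.sum_le_sum fun j _ => ?_
        rw [mul_diagonal, mul_pow]
        refine mul_le_of_le_one_right (sq_nonneg _) ?_
        rcases hd j with h | h <;> rw [h]
        · norm_num
        · nlinarith [ha.1, ha.2]
      have h2 : 0 ≤ ∑ i, b (ℓ + 1) i ^ 2 := by positivity
      rw [paramNorm_succ n W b (ℓ + 1)]
      push_cast
      linarith

open Matrix in
theorem matrix_eq_of_affine_eqOn_open {p q : ℕ} {M A : Matrix (Fin p) (Fin q) ℝ}
    {c b : Fin p → ℝ} {U : Set (Fin q → ℝ)} (hU : IsOpen U) (hne : U.Nonempty)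
    (h : ∀ x ∈ U, M *ᵥ x + c = A *ᵥ x + b) : M = A := by
  obtain ⟨x₀, hx₀⟩ := hne
  refine Matrix.ext_of_mulVec_single fun j => ?_
  have hcont : Continuous fun t : ℝ => x₀ + t • (Pi.single j 1 : Fin q → ℝ) := by fun_prop
  have hev : ∀ᶠ t in nhds (0 : ℝ), x₀ + t • (Pi.single j 1 : Fin q → ℝ) ∈ U :=
    hcont.continuousAt.eventually_mem (by simpa using hU.mem_nhds hx₀)
  obtain ⟨t, ht, ht0⟩ := ((hev.filter_mono nhdsWithin_le_nhds).and
    (self_mem_nhdsWithin : {0}ᶜ ∈ nhdsWithin (0 : ℝ) {0}ᶜ)).exists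
  have h0 := h _ hx₀
  have h1 := h _ ht
  rw [mulVec_add, mulVec_add, mulVec_smul, mulVec_smul] at h1
  have h2 : t • (M *ᵥ Pi.single j 1) = t • (A *ᵥ Pi.single j 1) := by
    funext i
    have e0 := congrFun h0 i
    have e1 := congrFun h1 i
    simp only [Pi.add_apply] at e0 e1
    linarith
  exact smul_right_injective _ ht0 h2

open Matrix in
/-- Rank factorization: `A = P Q`, where the columns of `P = A V` are linearly independent. -/
theorem exists_rank_factorization {p q : ℕ} (A : Matrix (Fin p) (Fin q) ℝ) :
    ∃ (V : Matrix (Fin q) (Fin A.rank) ℝ) (Q : Matrix (Fin A.rank) (Fin q) ℝ),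
      A = A * V * Q ∧ 0 < ((A * V)ᵀ * (A * V)).det := by
  let B : Module.Basis (Fin A.rank) ℝ (LinearMap.range A.mulVecLin) :=
    Module.finBasisOfFinrankEq ℝ _ rfl
  choose v hv using fun i => (B i).2
  set V : Matrix (Fin q) (Fin A.rank) ℝ := Matrix.of fun i j => v j i with hVdef
  have hAV : ∀ y, (A * V) *ᵥ y = (B.equivFun.symm y : Fin p → ℝ) := by
    intro y
    have hVy : V *ᵥ y = ∑ i, y i • v i := by
      funext k
      simp [hVdef, mulVec, dotProduct, mul_comm]
    rw [← mulVec_mulVec, hVy, ← mulVecLin_apply, map_sum, Module.Basis.equivFun_symm_apply]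
    simp only [map_smul, hv, Submodule.coe_sum, Submodule.coe_smul]
  refine ⟨V, LinearMap.toMatrix' (B.equivFun.toLinearMap ∘ₗ A.mulVecLin.rangeRestrict), ?_, ?_⟩
  · refine Matrix.ext_of_mulVec_single fun j => ?_
    rw [← mulVec_mulVec, hAV, ← toLin'_apply (LinearMap.toMatrix' _), toLin'_toMatrix']
    simp only [LinearMap.comp_apply, LinearEquiv.coe_coe, LinearEquiv.symm_apply_apply]
    rfl
  · have hinj : Function.Injective (A * V).mulVec := by
      intro y z hyz
      rw [hAV, hAV] at hyz
      exact B.equivFun.symm.injective (Subtype.ext hyz)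
    simpa [conjTranspose_eq_transpose_of_trivial] using
      (PosDef.conjTranspose_mul_self (A * V) hinj).det_pos

open Matrix in
theorem le_repCost_of_affine {din dout : ℕ} {a : ℝ} (ha : a ∈ Set.Ioo (-1 : ℝ) 1)
    (A : Matrix (Fin dout) (Fin din) ℝ) (b : EuclideanSpace ℝ (Fin dout))
    (f : EuclideanSpace ℝ (Fin din) → EuclideanSpace ℝ (Fin dout))
    (hf : ∀ x, ∀ j, f x j = A.mulVec x j + b j)
    (Ω : Set (EuclideanSpace ℝ (Fin din))) (hΩopen : IsOpen Ω) (hΩne : Ω.Nonempty) :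
    ∃ C : ℝ, ∀ L : ℕ, ENNReal.ofReal (A.rank * L - C) ≤ repCost a f Ω L := by
  obtain ⟨V, Q, -, hV⟩ := exists_rank_factorization A
  refine ⟨Real.log (Vᵀ * V).det - Real.log ((A * V)ᵀ * (A * V)).det, fun L => le_sInf ?_⟩
  rintro _ ⟨L', rfl, n, h0, hL, W, β, hnet, rfl⟩
  subst h0 hL
  refine ENNReal.ofReal_le_ofReal ?_
  obtain ⟨U', hsub, hopen, hne, M, c, hM, hdet⟩ := exists_open_netOut_affine ha n W β
    (U := WithLp.toLp 2 ⁻¹' Ω) (hΩopen.preimage (PiLp.continuous_toLp 2 _))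
    (hΩne.preimage (WithLp.toLp_surjective 2)) V L'
  have hMA : M = A := by
    refine matrix_eq_of_affine_eqOn_open (c := c) (b := b) hopen hne fun x hx => ?_
    rw [← hM x hx]
    funext j
    have := hnet _ (hsub hx) j
    rw [hf] at this
    exact this
  rw [hMA] at hdet
  have hpos : 0 < (Vᵀ * V).det :=
    pos_of_mul_pos_right (hV.trans_le hdet) (Real.exp_pos _).le
  have := Real.log_le_log hV hdet
  rw [Real.log_mul (Real.exp_pos _).ne' hpos.ne', Real.log_exp] at this
  push_cast
  linarith

/-- Weights of the network that applies `Q`, then `m` identity layers, then `P`. -/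
def relayWeight (Q P : ℕ → ℕ → ℝ) (m ℓ i j : ℕ) : ℝ :=
  if ℓ = 0 then Q i j else if ℓ = m + 1 then P i j else if i = j then 1 else 0

/-- Biases of the network with weights `relayWeight`: `K` in the first layer, `c` in the last. -/
def relayBias (K : ℝ) (c : ℕ → ℝ) (m ℓ i : ℕ) : ℝ :=
  if ℓ = 0 then K else if ℓ = m + 1 then c i else 0

theorem netOut_relay_hidden (a : ℝ) {n : ℕ → ℕ} {m r : ℕ} (hn : ∀ ℓ ≤ m, n (ℓ + 1) = r)
    (Q P : ℕ → ℕ → ℝ) (K : ℝ) (c : ℕ → ℝ) (x : Fin (n 0) → ℝ)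
    (hpos : ∀ i < r, 0 ≤ (∑ j : Fin (n 0), Q i j * x j) + K) {ℓ : ℕ} (hℓ : ℓ ≤ m)
    (i : Fin (n (ℓ + 1))) :
    netOut a n (fun ℓ i j => relayWeight Q P m ℓ i j) (fun ℓ i => relayBias K c m ℓ i) ℓ x i =
      (∑ j : Fin (n 0), Q i j * x j) + K := by
  induction ℓ with
  | zero => simp [netOut, relayWeight, relayBias, Matrix.mulVec, dotProduct]
  | succ ℓ ih =>
    have hℓ' : ℓ ≠ m := by omega
    have hi : (i : ℕ) < r := (hn (ℓ + 1) hℓ) ▸ i.2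
    have hi' : (i : ℕ) < n (ℓ + 1) := by rw [hn ℓ (by omega)]; exact hi
    simp only [netOut, Pi.add_apply, Matrix.mulVec, dotProduct, ih (by omega)]
    rw [Fin.sum_univ_eq_sum_range (fun k => relayWeight Q P m (ℓ + 1) i k *
      sigmaA a ((∑ j : Fin (n 0), Q k j * x j) + K))]
    simp [relayWeight, relayBias, hℓ', hi']
    simp [sigmaA, hpos i hi]

theorem netOut_relay (a : ℝ) {n : ℕ → ℕ} {m r : ℕ} (hn : ∀ ℓ ≤ m, n (ℓ + 1) = r)
    (Q P : ℕ → ℕ → ℝ) (K : ℝ) (c : ℕ → ℝ) (x : Fin (n 0) → ℝ)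
    (hpos : ∀ i < r, 0 ≤ (∑ j : Fin (n 0), Q i j * x j) + K) (i : Fin (n (m + 1 + 1))) :
    netOut a n (fun ℓ i j => relayWeight Q P m ℓ i j) (fun ℓ i => relayBias K c m ℓ i)
        (m + 1) x i =
      ∑ k : Fin r, P i k * ((∑ j : Fin (n 0), Q k j * x j) + K) + c i := by
  simp only [netOut, Pi.add_apply, Matrix.mulVec, dotProduct,
    netOut_relay_hidden a hn Q P K c x hpos le_rfl]
  rw [Fin.sum_univ_eq_sum_range (fun k => relayWeight Q P m (m + 1) i k *
    sigmaA a ((∑ j : Fin (n 0), Q k j * x j) + K)), hn m le_rfl, Finset.sum_range]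
  simp [relayWeight, relayBias, sigmaA, hpos]

theorem paramNorm_relay {n : ℕ → ℕ} {m r : ℕ} (hn : ∀ ℓ ≤ m, n (ℓ + 1) = r)
    (Q P : ℕ → ℕ → ℝ) (K : ℝ) (c : ℕ → ℝ) :
    paramNorm n (fun ℓ i j => relayWeight Q P m ℓ i j) (fun ℓ i => relayBias K c m ℓ i)
        (m + 1 + 1) =
      m * r + ((∑ i ∈ Finset.range r, ∑ j ∈ Finset.range (n 0), Q i j ^ 2) + r * K ^ 2) +
      ((∑ i ∈ Finset.range (n (m + 1 + 1)), ∑ j ∈ Finset.range r, P i j ^ 2) +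
        ∑ i ∈ Finset.range (n (m + 1 + 1)), c i ^ 2) := by
  have hsum : ∀ ℓ, ((∑ i : Fin (n (ℓ + 1)), ∑ j : Fin (n ℓ), relayWeight Q P m ℓ i j ^ 2) +
      ∑ i : Fin (n (ℓ + 1)), relayBias K c m ℓ i ^ 2) =
      (∑ i ∈ Finset.range (n (ℓ + 1)), ∑ j ∈ Finset.range (n ℓ), relayWeight Q P m ℓ i j ^ 2) +
      ∑ i ∈ Finset.range (n (ℓ + 1)), relayBias K c m ℓ i ^ 2 := by
    intro ℓ
    simp only [Finset.sum_range]
  simp only [paramNorm, hsum]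
  rw [Finset.sum_range_succ, Finset.sum_range_succ']
  have hmid : ∀ ℓ ∈ Finset.range m, ((∑ i ∈ Finset.range (n (ℓ + 1 + 1)),
      ∑ j ∈ Finset.range (n (ℓ + 1)), relayWeight Q P m (ℓ + 1) i j ^ 2) +
      ∑ i ∈ Finset.range (n (ℓ + 1 + 1)), relayBias K c m (ℓ + 1) i ^ 2) = (r : ℝ) := by
    intro ℓ hℓ
    have hℓm := Finset.mem_range.mp hℓ
    rw [hn ℓ hℓm.le, hn (ℓ + 1) hℓm]
    have : ∀ i ∈ Finset.range r,
        ∑ j ∈ Finset.range r, relayWeight Q P m (ℓ + 1) i j ^ 2 = (1 : ℝ) := by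
      intro i hi
      simp [relayWeight, hℓm.ne, ite_pow, Finset.mem_range.mp hi]
    rw [Finset.sum_congr rfl this]
    simp [relayBias, hℓm.ne]
  rw [Finset.sum_congr rfl hmid, hn m le_rfl, hn 0 (Nat.zero_le _)]
  simp [relayWeight, relayBias]

open Matrix in
theorem repCost_le_of_affine {din dout : ℕ} (a : ℝ)
    (A : Matrix (Fin dout) (Fin din) ℝ) (b : EuclideanSpace ℝ (Fin dout))
    (f : EuclideanSpace ℝ (Fin din) → EuclideanSpace ℝ (Fin dout))
    (hf : ∀ x, ∀ j, f x j = A.mulVec x j + b j)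
    (Ω : Set (EuclideanSpace ℝ (Fin din))) (hΩbdd : Bornology.IsBounded Ω) :
    ∃ C : ℝ, ∀ L : ℕ, 2 ≤ L → repCost a f Ω L ≤ ENNReal.ofReal (A.rank * L + C) := by
  obtain ⟨r, hr, P, Q, hAQ⟩ : ∃ r, r = A.rank ∧ ∃ (P : Matrix (Fin dout) (Fin r) ℝ)
      (Q : Matrix (Fin r) (Fin din) ℝ), A = P * Q := by
    obtain ⟨V, Q, hAQ, -⟩ := exists_rank_factorization A
    exact ⟨_, rfl, A * V, Q, hAQ⟩
  rw [← hr]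
  obtain ⟨R, hR⟩ := isBounded_iff_forall_norm_le.mp hΩbdd
  set K : ℝ := ∑ k, ∑ i, |Q k i| * R
  let Qn : ℕ → ℕ → ℝ := fun i j => if h : i < r ∧ j < din then Q ⟨i, h.1⟩ ⟨j, h.2⟩ else 0
  let Pn : ℕ → ℕ → ℝ := fun i j => if h : i < dout ∧ j < r then P ⟨i, h.1⟩ ⟨j, h.2⟩ else 0
  let c : ℕ → ℝ := fun i => if h : i < dout then b ⟨i, h⟩ - ∑ k, P ⟨i, h⟩ k * K else 0
  refine ⟨((∑ i ∈ Finset.range r, ∑ j ∈ Finset.range din, Qn i j ^ 2) + r * K ^ 2) +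
      ((∑ i ∈ Finset.range dout, ∑ j ∈ Finset.range r, Pn i j ^ 2) +
        ∑ i ∈ Finset.range dout, c i ^ 2), fun L hL => ?_⟩
  obtain ⟨m, rfl⟩ : ∃ m, L = m + 1 + 1 := ⟨L - 2, by omega⟩
  let n : ℕ → ℕ := fun ℓ => if ℓ = 0 then din else if ℓ ≤ m + 1 then r else dout
  have hn : ∀ ℓ ≤ m, n (ℓ + 1) = r := fun ℓ hℓ => by simp [n, hℓ]
  have hn0 : n 0 = din := rfl
  have hnL : n (m + 1 + 1) = dout := by simp [n]
  let W : ∀ ℓ, Matrix (Fin (n (ℓ + 1))) (Fin (n ℓ)) ℝ := fun ℓ i j => relayWeight Qn Pn m ℓ i j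
  let β : ∀ ℓ, Fin (n (ℓ + 1)) → ℝ := fun ℓ i => relayBias K c m ℓ i
  refine le_trans (b := ENNReal.ofReal (paramNorm n W β (m + 1 + 1)))
    (sInf_le ⟨m + 1, rfl, n, hn0, hnL, W, β, fun x hx j => ?_, rfl⟩)
    (ENNReal.ofReal_le_ofReal ?_)
  · have hQx : ∀ k : Fin r,
        ∑ i : Fin (n 0), Qn k i * x (Fin.cast hn0 i) = (Q *ᵥ x) k := by
      intro k
      show ∑ i : Fin din, Qn k i * x i = _
      simp [Qn, mulVec, dotProduct]
    have hpos : ∀ k < r, 0 ≤ (∑ i : Fin (n 0), Qn k i * x (Fin.cast hn0 i)) + K := by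
      intro k hk
      rw [hQx ⟨k, hk⟩]
      have hR0 : 0 ≤ R := (norm_nonneg x).trans (hR x hx)
      have h1 : |(Q *ᵥ x) ⟨k, hk⟩| ≤ ∑ i, |Q ⟨k, hk⟩ i| * R := by
        rw [mulVec, dotProduct]
        refine (Finset.abs_sum_le_sum_abs _ _).trans (Finset.sum_le_sum fun i _ => ?_)
        rw [abs_mul]
        exact mul_le_mul_of_nonneg_left
          ((PiLp.norm_apply_le x i).trans (hR x hx)) (abs_nonneg _)
      have h2 : ∑ i, |Q ⟨k, hk⟩ i| * R ≤ K :=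
        Finset.single_le_sum (f := fun k => ∑ i, |Q k i| * R)
          (fun _ _ => Finset.sum_nonneg fun _ _ => mul_nonneg (abs_nonneg _) hR0)
          (Finset.mem_univ _)
      linarith [neg_abs_le ((Q *ᵥ x) ⟨k, hk⟩)]
    have hAx : A *ᵥ x = P *ᵥ (Q *ᵥ x) := by rw [mulVec_mulVec, ← hAQ]
    rw [netOut_relay a hn Qn Pn K c _ hpos, hf, hAx]
    simp only [hQx]
    simp [Pn, c, mulVec, dotProduct, mul_add, Finset.sum_add_distrib]
  · rw [paramNorm_relay hn Qn Pn K c, hn0, hnL]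
    have : (0 : ℝ) ≤ r := Nat.cast_nonneg r
    push_cast
    nlinarith

/-- for an affine map f(x) = Ax + b and a nonempty bounded open set Ω, the
rescaled representation cost R(f;Ω,σ_a,L)/L converges, as L → ∞, to the rank of A. -/
theorem repCost_affine_tendsto_rank {din dout : ℕ} (a : ℝ) (ha : a ∈ Set.Ioo (-1 : ℝ) 1)
    (A : Matrix (Fin dout) (Fin din) ℝ) (b : EuclideanSpace ℝ (Fin dout))
    (f : EuclideanSpace ℝ (Fin din) → EuclideanSpace ℝ (Fin dout))
    (hf : ∀ x, ∀ j, f x j = A.mulVec x j + b j)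
    (Ω : Set (EuclideanSpace ℝ (Fin din))) (hΩopen : IsOpen Ω) (hΩne : Ω.Nonempty)
    (hΩbdd : Bornology.IsBounded Ω) :
    Filter.Tendsto (fun L : ℕ => repCost a f Ω L / (L : ℝ≥0∞)) Filter.atTop
      (nhds (A.rank : ℝ≥0∞)) := by
  obtain ⟨C₁, hC₁⟩ := le_repCost_of_affine ha A b f hf Ω hΩopen hΩne
  obtain ⟨C₂, hC₂⟩ := repCost_le_of_affine a A b f hf Ω hΩbdd
  have key : ∀ C : ℝ, Filter.Tendsto
      (fun L : ℕ => ENNReal.ofReal (A.rank * L + C) / (L : ℝ≥0∞)) Filter.atTop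
      (nhds (A.rank : ℝ≥0∞)) := by
    intro C
    have h1 : Filter.Tendsto (fun L : ℕ => (A.rank : ℝ) + C / L) Filter.atTop
        (nhds (A.rank : ℝ)) := by
      simpa using tendsto_const_nhds.add (tendsto_const_div_atTop_nhds_zero_nat C)
    have h2 := ENNReal.tendsto_ofReal h1
    rw [ENNReal.ofReal_natCast] at h2
    refine h2.congr' ?_
    filter_upwards [Filter.eventually_gt_atTop 0] with L hL
    have hL' : (0 : ℝ) < L := Nat.cast_pos.mpr hL
    rw [← ENNReal.ofReal_natCast L, ← ENNReal.ofReal_div_of_pos hL']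
    congr 1
    field_simp
  refine tendsto_of_tendsto_of_tendsto_of_le_of_le' (key (-C₁)) (key C₂) ?_ ?_
  · exact Filter.Eventually.of_forall fun L => ENNReal.div_le_div_right
      (by simpa [sub_eq_add_neg] using hC₁ L) _
  · filter_upwards [Filter.eventually_ge_atTop 2] with L hL
    exact ENNReal.div_le_div_right (hC₂ L hL) _
end
end

section
/- Fix a ∈ (−1,1), λ > 0, a depth L ≥ 2, a fixed architecture with widths n₀,…,n_L, and any function C from functions ℝ^{n₀} → ℝ^{n_L} to ℝ. If W = (W₁,b₁,…,W_L,b_L) is a local minimum (in the parameter space of this fixed architecture) of the map W ↦ C(f_W) + λ‖W‖², then for every ℓ ∈ {1,…,L−1}: ‖W_ℓ‖_F² + ‖b_ℓ‖² = ‖W_{ℓ+1}‖_F². -/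
noncomputable section

open scoped ENNReal

theorem sigmaA_mul_of_nonneg (a : ℝ) {r : ℝ} (hr : 0 ≤ r) (x : ℝ) :
    sigmaA a (r * x) = r * sigmaA a x := by
  rcases hr.eq_or_lt with rfl | hr
  · simp [sigmaA]
  · simp only [sigmaA, mul_nonneg_iff_of_pos_left hr]
    split_ifs <;> ring

/-- Rescaling the weights of each layer by `c ℓ` and the biases by `d ℓ`, where `d ℓ` is the
product of the `c k` over `k ≤ ℓ`, multiplies the output of layer `ℓ` by `d ℓ`. -/
theorem netOut_smul (a : ℝ) (n : ℕ → ℕ) (W : ∀ ℓ, Matrix (Fin (n (ℓ + 1))) (Fin (n ℓ)) ℝ)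
    (b : ∀ ℓ, Fin (n (ℓ + 1)) → ℝ) (c d : ℕ → ℝ) (hd : ∀ ℓ, 0 ≤ d ℓ) (h0 : d 0 = c 0)
    (hsucc : ∀ ℓ, d (ℓ + 1) = c (ℓ + 1) * d ℓ) (ℓ : ℕ) (x : Fin (n 0) → ℝ) :
    netOut a n (fun k => c k • W k) (fun k => d k • b k) ℓ x = d ℓ • netOut a n W b ℓ x := by
  induction ℓ with
  | zero => simp [netOut, Matrix.smul_mulVec, h0]
  | succ ℓ ih =>
    have hσ : (fun i => sigmaA a (d ℓ * netOut a n W b ℓ x i)) =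
        d ℓ • fun i => sigmaA a (netOut a n W b ℓ x i) :=
      funext fun i => sigmaA_mul_of_nonneg a (hd ℓ) _
    simp only [netOut, ih, Pi.smul_apply, smul_eq_mul, hσ, Matrix.smul_mulVec, Matrix.mulVec_smul,
      smul_smul, smul_add, hsucc, mul_comm (c (ℓ + 1))]

theorem paramNorm_smul (n : ℕ → ℕ) (W : ∀ ℓ, Matrix (Fin (n (ℓ + 1))) (Fin (n ℓ)) ℝ)
    (b : ∀ ℓ, Fin (n (ℓ + 1)) → ℝ) (c d : ℕ → ℝ) (L : ℕ) :
    paramNorm n (fun k => c k • W k) (fun k => d k • b k) L =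
      ∑ ℓ ∈ Finset.range L,
        (c ℓ ^ 2 * (∑ i, ∑ t, W ℓ i t ^ 2) + d ℓ ^ 2 * ∑ i, b ℓ i ^ 2) := by
  simp only [paramNorm, Matrix.smul_apply, Pi.smul_apply, smul_eq_mul, mul_pow, Finset.mul_sum]

theorem hasDerivAt_exp_mul_sq (u : ℝ) :
    HasDerivAt (fun s : ℝ => Real.exp (u * s) ^ 2) (2 * u) 0 := by
  have h := (((hasDerivAt_id (0 : ℝ)).const_mul u).exp).pow 2
  simpa [Pi.pow_def] using h

/-- balancedness at local minima.  For a fixed architecture of depth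
L = L' + 1 ≥ 2, any cost C on represented functions, and λ > 0, a local minimum
(in parameter space) of W ↦ C(f_W) + λ‖W‖² satisfies, for every layer
ℓ ∈ {1, …, L−1} (here 0-indexed as ℓ - 1 < L'):
‖W_ℓ‖_F² + ‖b_ℓ‖² = ‖W_{ℓ+1}‖_F². -/
theorem balancedness_at_local_min (a : ℝ) (ha : a ∈ Set.Ioo (-1 : ℝ) 1)
    (lam : ℝ) (hlam : 0 < lam) (L' : ℕ) (hL : 1 ≤ L') (n : ℕ → ℕ)
    (C : ((Fin (n 0) → ℝ) → (Fin (n (L' + 1)) → ℝ)) → ℝ)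
    (Wb : (∀ ℓ, Matrix (Fin (n (ℓ + 1))) (Fin (n ℓ)) ℝ) × (∀ ℓ, Fin (n (ℓ + 1)) → ℝ))
    (hmin : IsLocalMin
      (fun p : (∀ ℓ, Matrix (Fin (n (ℓ + 1))) (Fin (n ℓ)) ℝ) ×
          (∀ ℓ, Fin (n (ℓ + 1)) → ℝ) =>
        C (netOut a n p.1 p.2 L') + lam * paramNorm n p.1 p.2 (L' + 1)) Wb) :
    ∀ j : ℕ, j < L' →
      (∑ i, ∑ t, (Wb.1 j i t) ^ 2) + ∑ i, (Wb.2 j i) ^ 2 =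
        ∑ i, ∑ t, (Wb.1 (j + 1) i t) ^ 2 := by
  intro j hj
  let v : ℕ → ℝ := fun ℓ => if ℓ = j then 1 else 0
  let u : ℕ → ℝ := fun ℓ => v ℓ - if ℓ = j + 1 then 1 else 0
  let γ : ℝ → (∀ ℓ, Matrix (Fin (n (ℓ + 1))) (Fin (n ℓ)) ℝ) × (∀ ℓ, Fin (n (ℓ + 1)) → ℝ) :=
    fun s => (fun ℓ => Real.exp (u ℓ * s) • Wb.1 ℓ, fun ℓ => Real.exp (v ℓ * s) • Wb.2 ℓ)
  have hγ : Continuous γ := by fun_prop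
  have hγ0 : γ 0 = Wb := by simp [γ]
  have hnet (s : ℝ) : netOut a n (γ s).1 (γ s).2 L' = netOut a n Wb.1 Wb.2 L' := by
    ext1 x
    have h := netOut_smul a n Wb.1 Wb.2 (fun ℓ => Real.exp (u ℓ * s))
      (fun ℓ => Real.exp (v ℓ * s)) (fun ℓ => (Real.exp_pos _).le) (by simp [u])
      (fun ℓ => by
        rw [← Real.exp_add]
        congr 1
        simp only [u, v, add_left_inj]
        ring) L' x
    simpa [γ, v, hj.ne'] using h
  rw [← hγ0] at hmin
  have hcomp := hmin.comp_continuous hγ.continuousAt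
  simp only [Function.comp_def, hnet] at hcomp
  have hderiv := (((HasDerivAt.fun_sum (u := Finset.range (L' + 1)) fun ℓ _ =>
    ((hasDerivAt_exp_mul_sq (u ℓ)).mul_const (∑ i, ∑ t, Wb.1 ℓ i t ^ 2)).fun_add
      ((hasDerivAt_exp_mul_sq (v ℓ)).mul_const (∑ i, Wb.2 ℓ i ^ 2))).const_mul lam).const_add
        (C (netOut a n Wb.1 Wb.2 L')))
  have hzero := IsLocalMin.hasDerivAt_eq_zero
    (by simpa only [γ, paramNorm_smul] using hcomp) hderiv
  have hsum := (mul_eq_zero.mp hzero).resolve_left hlam.ne'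
  simp only [u, v, mul_sub, sub_mul, mul_ite, ite_mul, mul_one, mul_zero, zero_mul,
    Finset.sum_add_distrib, Finset.sum_sub_distrib, Finset.sum_ite_eq', Finset.mem_range,
    add_lt_add_iff_right, hj, hj.trans (Nat.lt_succ_self L'), if_true] at hsum
  linarith
end
end
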